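/- Let g, h be 3-Lie algebras over a field K of characteristic 0 and (ρ,ν,ω) extension data such that (g⊕h, [·,·,·]_{(ρ,ν,ω)}) is a 3-Lie algebra. Let σ: ∧²g → ∧²(g⊕h) and ι: (∧²h)⊕(g⊗h) → ∧²(g⊕h) be the canonical embeddings (σ(y∧z) = y∧z; ι(u∧v) = u∧v, ι(x⊗w) = x∧w). Define ϖ(x∧y, z∧t) = −t⊗ω(x,y,z) + z⊗ω(x,y,t); l(x∧y)(u∧v + z⊗w) = ρ(x,y)(u)∧v + u∧ρ(x,y)(v) + [x,y,z]_g⊗w + ω(x,y,z)∧w + z⊗ρ(x,y)(w); r(x∧y)(u∧v + z⊗w) = −y⊗ν(x)(u,v) + x⊗ν(y)(u,v) + y⊗ρ(z,x)(w) − x⊗ρ(z,y)(w). Then for all Y1 = y1∧z1, Y2 = y2∧z2 ∈ ∧²g and m, n ∈ (∧²h)⊕(g⊗h): [σ(Y1) + ι(m), σ(Y2) + ι(n)]_F̂ = σ([Y1,Y2]_F) + ι( {m,n} + l(Y1)(n) + r(Y2)(m) + ϖ(Y1,Y2) ). -/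

import Mathlib

open scoped TensorProduct

section

variable {K : Type*} [Field K]
variable {g h : Type*} [AddCommGroup g] [Module K g] [AddCommGroup h] [Module K h]

/-- The bracket `[·,·,·]_{(ρ,ν,ω)}` on `g ⊕ h` built from extension data. -/
def extBracket (bg : g →ₗ[K] g →ₗ[K] g →ₗ[K] g) (bh : h →ₗ[K] h →ₗ[K] h →ₗ[K] h)
    (ρ : g →ₗ[K] g →ₗ[K] Module.End K h)
    (ν : g →ₗ[K] h →ₗ[K] h →ₗ[K] h)
    (ω : g →ₗ[K] g →ₗ[K] g →ₗ[K] h) :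
    g × h → g × h → g × h → g × h :=
  fun a b c =>
    (bg a.1 b.1 c.1,
      ω a.1 b.1 c.1 + ρ a.1 b.1 c.2 + ρ b.1 c.1 a.2 + ρ c.1 a.1 b.2
        + ν a.1 b.2 c.2 + ν b.1 c.2 a.2 + ν c.1 a.2 b.2 + bh a.2 b.2 c.2)

end

/-- The simple wedge `x ∧ y` in the second exterior power `⋀[K]^2 g`. -/
noncomputable def wedge2 (K : Type*) [Field K] {g : Type*} [AddCommGroup g] [Module K g]
    (x y : g) : ⋀[K]^2 g :=
  ⟨ExteriorAlgebra.ιMulti K 2 ![x, y], ExteriorAlgebra.ιMulti_range K 2 (Set.mem_range_self _)⟩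

section

variable {K : Type*} [Field K]
variable {g h : Type*} [AddCommGroup g] [Module K g] [AddCommGroup h] [Module K h]

theorem wedge2_self (x : g) : wedge2 K x x = 0 :=
  (exteriorPower.ιMulti K 2).map_eq_zero_of_eq ![x, x] (i := 0) (j := 1) rfl (by decide)

theorem wedge2_add_left (x x' y : g) : wedge2 K (x + x') y = wedge2 K x y + wedge2 K x' y := by
  have hadd := (exteriorPower.ιMulti K 2).map_update_add ![x, y] 0 x x'
  have hupd (z : g) : Function.update ![x, y] 0 z = ![z, y] := by
    ext i; fin_cases i <;> rfl
  rwa [hupd, hupd, hupd] at hadd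

theorem wedge2_add_right (x y y' : g) : wedge2 K x (y + y') = wedge2 K x y + wedge2 K x y' := by
  have hadd := (exteriorPower.ιMulti K 2).map_update_add ![x, y] 1 y y'
  have hupd (z : g) : Function.update ![x, y] 1 z = ![x, z] := by
    ext i; fin_cases i <;> rfl
  rwa [hupd, hupd, hupd] at hadd

theorem wedge2_zero_left (y : g) : wedge2 K 0 y = 0 := by
  simpa using wedge2_add_left (K := K) 0 0 y

theorem wedge2_zero_right (x : g) : wedge2 K x 0 = 0 := by
  simpa using wedge2_add_right (K := K) x 0 0

theorem wedge2_neg_left (x y : g) : wedge2 K (-x) y = -wedge2 K x y := by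
  rw [eq_neg_iff_add_eq_zero, ← wedge2_add_left, neg_add_cancel, wedge2_zero_left]

theorem wedge2_swap (x y : g) : wedge2 K x y = -wedge2 K y x := by
  have hxy := wedge2_self (K := K) (x + y)
  rw [wedge2_add_left, wedge2_add_right, wedge2_add_right, wedge2_self, wedge2_self] at hxy
  rw [eq_neg_iff_add_eq_zero]
  simpa using hxy

/-- Linear maps out of `⋀²h ⊕ (g ⊗ h)` are determined by their values on simple wedges and
simple tensors. -/
theorem wedge2_prod_tensor_ext {N : Type*} [AddCommGroup N] [Module K N]
    {f f' : (⋀[K]^2 h × (g ⊗[K] h)) →ₗ[K] N}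
    (hw : ∀ u v : h, f (wedge2 K u v, 0) = f' (wedge2 K u v, 0))
    (ht : ∀ (x : g) (w : h), f (0, x ⊗ₜ[K] w) = f' (0, x ⊗ₜ[K] w)) : f = f' := by
  refine LinearMap.prod_ext (exteriorPower.linearMap_ext ?_) (TensorProduct.ext' ht)
  ext a
  have ha : a = ![a 0, a 1] := by ext i; fin_cases i <;> rfl
  rw [ha]
  exact hw (a 0) (a 1)

theorem wedge2_prod_left (x : g) (w : h) (e : g × h) :
    wedge2 K (x, w) e = wedge2 K (x, 0) e + wedge2 K (0, w) e := by
  rw [← wedge2_add_left]; simp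

theorem wedge2_prod_right (x : g) (w : h) (e : g × h) :
    wedge2 K e (x, w) = wedge2 K e (x, 0) + wedge2 K e (0, w) := by
  rw [← wedge2_add_right]; simp

end

/-- under the decomposition `⋀²(g⊕h) ≅ ((⋀²h) ⊕ (g⊗h)) ⊕ ⋀²g`, the
fundamental bracket of the extension decomposes via the bracket `{·,·}`, the actions
`l`, `r` and the cocycle `ϖ`. -/
theorem fundamental_bracket_decomposition {K : Type*} [Field K] [CharZero K]
    {g h : Type*} [AddCommGroup g] [Module K g] [AddCommGroup h] [Module K h]
    (bg : g →ₗ[K] g →ₗ[K] g →ₗ[K] g) (bh : h →ₗ[K] h →ₗ[K] h →ₗ[K] h)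
    (hgalt : ∀ x y z : g, x = y ∨ y = z ∨ x = z → bg x y z = 0)
    (hgfi : ∀ x1 x2 x3 x4 x5 : g,
      bg x1 x2 (bg x3 x4 x5)
        = bg (bg x1 x2 x3) x4 x5 + bg x3 (bg x1 x2 x4) x5 + bg x3 x4 (bg x1 x2 x5))
    (hhalt : ∀ u v w : h, u = v ∨ v = w ∨ u = w → bh u v w = 0)
    (hhfi : ∀ v1 v2 v3 v4 v5 : h,
      bh v1 v2 (bh v3 v4 v5)
        = bh (bh v1 v2 v3) v4 v5 + bh v3 (bh v1 v2 v4) v5 + bh v3 v4 (bh v1 v2 v5))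
    (ρ : g →ₗ[K] g →ₗ[K] Module.End K h) (hρ : ∀ x y : g, ρ x y = - ρ y x)
    (ν : g →ₗ[K] h →ₗ[K] h →ₗ[K] h) (hν : ∀ (x : g) (u v : h), ν x u v = - ν x v u)
    (ω : g →ₗ[K] g →ₗ[K] g →ₗ[K] h)
    (hω : ∀ x y z : g, x = y ∨ y = z ∨ x = z → ω x y z = 0)
    (healt : ∀ a b c : g × h, a = b ∨ b = c ∨ a = c → extBracket bg bh ρ ν ω a b c = 0)
    (hefi : ∀ a1 a2 a3 a4 a5 : g × h,
      extBracket bg bh ρ ν ω a1 a2 (extBracket bg bh ρ ν ω a3 a4 a5)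
        = extBracket bg bh ρ ν ω (extBracket bg bh ρ ν ω a1 a2 a3) a4 a5
          + extBracket bg bh ρ ν ω a3 (extBracket bg bh ρ ν ω a1 a2 a4) a5
          + extBracket bg bh ρ ν ω a3 a4 (extBracket bg bh ρ ν ω a1 a2 a5))
    -- the fundamental bracket [·,·]_F̂ on ⋀²(g⊕h):
    (F : ⋀[K]^2 (g × h) →ₗ[K] ⋀[K]^2 (g × h) →ₗ[K] ⋀[K]^2 (g × h))
    (hF : ∀ e1 e2 f1 f2 : g × h,
      F (wedge2 K e1 e2) (wedge2 K f1 f2)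
        = wedge2 K (extBracket bg bh ρ ν ω e1 e2 f1) f2
          + wedge2 K f1 (extBracket bg bh ρ ν ω e1 e2 f2))
    -- the fundamental bracket [·,·]_F on ⋀²g:
    (Fg : ⋀[K]^2 g →ₗ[K] ⋀[K]^2 g →ₗ[K] ⋀[K]^2 g)
    (hFg : ∀ x1 x2 y1 y2 : g,
      Fg (wedge2 K x1 x2) (wedge2 K y1 y2)
        = wedge2 K (bg x1 x2 y1) y2 + wedge2 K y1 (bg x1 x2 y2))
    -- the bracket {·,·} on (⋀²h) ⊕ (g ⊗ h):
    (B : (⋀[K]^2 h × (g ⊗[K] h)) →ₗ[K] (⋀[K]^2 h × (g ⊗[K] h)) →ₗ[K]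
          (⋀[K]^2 h × (g ⊗[K] h)))
    (hB : ∀ (u1 v1 u2 v2 w1 w2 : h) (x1 x2 : g),
      B (wedge2 K u1 v1, x1 ⊗ₜ[K] w1) (wedge2 K u2 v2, x2 ⊗ₜ[K] w2)
        = (wedge2 K (bh u1 v1 u2) v2 + wedge2 K u2 (bh u1 v1 v2)
            + wedge2 K (ν x2 u1 v1) w2 + wedge2 K (ν x1 w1 u2) v2
            + wedge2 K u2 (ν x1 w1 v2) - wedge2 K (ρ x1 x2 w1) w2,
           x2 ⊗ₜ[K] (bh u1 v1 w2) + x2 ⊗ₜ[K] (ν x1 w1 w2)))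
    -- the canonical embeddings ι and σ:
    (ι : (⋀[K]^2 h × (g ⊗[K] h)) →ₗ[K] ⋀[K]^2 (g × h))
    (hι1 : ∀ u v : h, ι (wedge2 K u v, 0) = wedge2 K ((0 : g), u) ((0 : g), v))
    (hι2 : ∀ (x : g) (w : h),
      ι (0, x ⊗ₜ[K] w) = wedge2 K (x, (0 : h)) ((0 : g), w))
    (σ : ⋀[K]^2 g →ₗ[K] ⋀[K]^2 (g × h))
    (hσ : ∀ y z : g, σ (wedge2 K y z) = wedge2 K (y, (0 : h)) (z, (0 : h)))
    -- the left action l: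
    (L : ⋀[K]^2 g →ₗ[K] (⋀[K]^2 h × (g ⊗[K] h)) →ₗ[K] (⋀[K]^2 h × (g ⊗[K] h)))
    (hL : ∀ (x y : g) (u v w : h) (z : g),
      L (wedge2 K x y) (wedge2 K u v, z ⊗ₜ[K] w)
        = (wedge2 K (ρ x y u) v + wedge2 K u (ρ x y v) + wedge2 K (ω x y z) w,
           (bg x y z) ⊗ₜ[K] w + z ⊗ₜ[K] (ρ x y w)))
    -- the right action r:
    (R : ⋀[K]^2 g →ₗ[K] (⋀[K]^2 h × (g ⊗[K] h)) →ₗ[K] (⋀[K]^2 h × (g ⊗[K] h)))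
    (hR : ∀ (x y : g) (u v w : h) (z : g),
      R (wedge2 K x y) (wedge2 K u v, z ⊗ₜ[K] w)
        = (0, - (y ⊗ₜ[K] (ν x u v)) + x ⊗ₜ[K] (ν y u v)
              + y ⊗ₜ[K] (ρ z x w) - x ⊗ₜ[K] (ρ z y w)))
    -- the cocycle ϖ:
    (W : ⋀[K]^2 g →ₗ[K] ⋀[K]^2 g →ₗ[K] (⋀[K]^2 h × (g ⊗[K] h)))
    (hW : ∀ x y z t : g,
      W (wedge2 K x y) (wedge2 K z t)
        = (0, - (t ⊗ₜ[K] (ω x y z)) + z ⊗ₜ[K] (ω x y t))) :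
    ∀ (y1 z1 y2 z2 : g) (m n : ⋀[K]^2 h × (g ⊗[K] h)),
      F (σ (wedge2 K y1 z1) + ι m) (σ (wedge2 K y2 z2) + ι n)
        = σ (Fg (wedge2 K y1 z1) (wedge2 K y2 z2))
          + ι (B m n + L (wedge2 K y1 z1) n + R (wedge2 K y2 z2) m
              + W (wedge2 K y1 z1) (wedge2 K y2 z2)) := by
  intro y1 z1 y2 z2 m n
  have hι (a : ⋀[K]^2 h) (b : g ⊗[K] h) : ι (a, b) = ι (a, 0) + ι (0, b) := by
    rw [← map_add]; simp
  have hι1_add (a b : ⋀[K]^2 h) : ι (a + b, 0) = ι (a, 0) + ι (b, 0) := by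
    rw [← map_add]; simp
  have hι2_add (a b : g ⊗[K] h) : ι (0, a + b) = ι (0, a) + ι (0, b) := by
    rw [← map_add]; simp
  have hι2_neg (a : g ⊗[K] h) : ι (0, -a) = -ι (0, a) := by
    rw [← map_neg]; simp
  have hσσ : F (σ (wedge2 K y1 z1)) (σ (wedge2 K y2 z2))
      = σ (Fg (wedge2 K y1 z1) (wedge2 K y2 z2))
        + ι (W (wedge2 K y1 z1) (wedge2 K y2 z2)) := by
    simp only [hσ, hF, hFg, hW, map_add, extBracket, map_zero, add_zero,
      hι2_add, hι2_neg, hι2]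
    rw [wedge2_prod_left (bg y1 z1 y2), wedge2_prod_right (bg y1 z1 z2),
      wedge2_swap (0, ω y1 z1 y2)]
    abel
  have hL1 (u v : h) (x y : g) : L (wedge2 K x y) (wedge2 K u v, 0)
      = (wedge2 K (ρ x y u) v + wedge2 K u (ρ x y v), 0) := by
    simpa [wedge2_zero_right] using hL x y u v 0 0
  have hL2 (x y z : g) (w : h) : L (wedge2 K x y) (0, z ⊗ₜ[K] w)
      = (wedge2 K (ω x y z) w, (bg x y z) ⊗ₜ[K] w + z ⊗ₜ[K] (ρ x y w)) := by
    simpa [wedge2_zero_right] using hL x y 0 0 w z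
  have hR1 (u v : h) (x y : g) : R (wedge2 K x y) (wedge2 K u v, 0)
      = (0, -(y ⊗ₜ[K] (ν x u v)) + x ⊗ₜ[K] (ν y u v)) := by
    simpa using hR x y u v 0 0
  have hR2 (x y z : g) (w : h) : R (wedge2 K x y) (0, z ⊗ₜ[K] w)
      = (0, y ⊗ₜ[K] (ρ z x w) - x ⊗ₜ[K] (ρ z y w)) := by
    simpa [wedge2_zero_right] using hR x y 0 0 w z
  have hB1 (u v u' v' : h) : B (wedge2 K u v, 0) (wedge2 K u' v', 0)
      = (wedge2 K (bh u v u') v' + wedge2 K u' (bh u v v'), 0) := by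
    simpa [wedge2_zero_right, wedge2_zero_left] using hB u v u' v' 0 0 0 0
  have hB2 (u v w : h) (x : g) : B (wedge2 K u v, 0) (0, x ⊗ₜ[K] w)
      = (wedge2 K (ν x u v) w, x ⊗ₜ[K] (bh u v w)) := by
    simpa [wedge2_zero_right, wedge2_zero_left] using hB u v 0 0 0 w 0 x
  have hB3 (u v w : h) (x : g) : B (0, x ⊗ₜ[K] w) (wedge2 K u v, 0)
      = (wedge2 K (ν x w u) v + wedge2 K u (ν x w v), 0) := by
    simpa [wedge2_zero_right, wedge2_zero_left] using hB 0 0 u v w 0 x 0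
  have hB4 (w w' : h) (x x' : g) : B (0, x ⊗ₜ[K] w) (0, x' ⊗ₜ[K] w')
      = (wedge2 K (-ρ x x' w) w', x' ⊗ₜ[K] (ν x w w')) := by
    simpa [wedge2_zero_right, wedge2_zero_left, wedge2_neg_left] using hB 0 0 0 0 w w' x x'
  have hσι : F (σ (wedge2 K y1 z1)) ∘ₗ ι = ι ∘ₗ L (wedge2 K y1 z1) := by
    apply wedge2_prod_tensor_ext
    · intro u v
      simp [hσ, hι1, hF, hL1, extBracket, hι1_add]
    · intro x w
      simp only [LinearMap.comp_apply, hσ, hι2, hF, hL2, extBracket, hι (wedge2 K _ _) (_ + _), hι1,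
        hι2_add, map_zero, LinearMap.zero_apply, add_zero, zero_add]
      rw [wedge2_prod_left (bg y1 z1 x)]
      abel
  have hισ : F.flip (σ (wedge2 K y2 z2)) ∘ₗ ι = ι ∘ₗ R (wedge2 K y2 z2) := by
    apply wedge2_prod_tensor_ext
    · intro u v
      simp only [LinearMap.comp_apply, LinearMap.flip_apply, hσ, hι1, hF, hR1, extBracket, hι2,
        hι2_add, hι2_neg, map_zero, LinearMap.zero_apply, add_zero, zero_add]
      rw [wedge2_swap (0, ν y2 u v)]
    · intro x w
      simp only [LinearMap.comp_apply, LinearMap.flip_apply, hσ, hF, hR2, extBracket, hι2,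
        sub_eq_add_neg, hι2_add, hι2_neg, map_zero, LinearMap.zero_apply, add_zero, zero_add]
      rw [wedge2_swap (0, ρ y2 x w), hρ y2 x, hρ z2 x]
      simp only [← hι2, LinearMap.neg_apply, TensorProduct.tmul_neg, hι2_neg, neg_neg]
  have hιι : F.compl₁₂ ι ι = B.compr₂ ι := by
    refine wedge2_prod_tensor_ext (N := _ →ₗ[K] ⋀[K]^2 (g × h)) ?_ ?_
    · intro u v
      apply wedge2_prod_tensor_ext
      · intro u' v'
        simp [hB1, hι1, hF, extBracket, hι1_add]
      · intro x w
        simp [hB2, hι1, hι2, hF, extBracket, hι (wedge2 K _ _) (_ ⊗ₜ _)]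
    · intro x w
      apply wedge2_prod_tensor_ext
      · intro u v
        simp [hB3, hι1, hι2, hF, extBracket, hι1_add]
      · intro x' w'
        simp [hB4, hι1, hι2, hF, extBracket, hι (wedge2 K _ _) (_ ⊗ₜ _), hρ x' x]
  have hσι' := LinearMap.congr_fun hσι n
  have hισ' := LinearMap.congr_fun hισ m
  have hιι' := LinearMap.congr_fun (LinearMap.congr_fun hιι m) n
  simp only [LinearMap.comp_apply, LinearMap.flip_apply, LinearMap.compl₁₂_apply,
    LinearMap.compr₂_apply] at hσι' hισ' hιι'
  simp only [map_add, LinearMap.add_apply, hσσ, hσι', hισ', hιι']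
  abel
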